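/- Let Ω be a finite index set, z : Ω → ℝ^d, λ ≥ 0, and f(S) = log det(I_d + λ Σ_{j∈S} z_j z_jᵀ) for S ⊆ Ω. Then f satisfies the equivalent lattice form of submodularity: for all S, T ⊆ Ω, f(S ∪ T) + f(S ∩ T) ≤ f(S) + f(T). -/

import Mathlib

open Matrix

/-- **Matrix determinant lemma** for a scaled rank-one update. -/
theorem Matrix.det_add_smul_vecMulVec {n R : Type*} [Fintype n] [DecidableEq n] [CommRing R]
    {M : Matrix n n R} (hM : IsUnit M.det) (c : R) (u v : n → R) :
    (M + c • vecMulVec u v).det = M.det * (1 + c * (v ⬝ᵥ M⁻¹ *ᵥ u)) := by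
  have h := det_add_replicateCol_mul_replicateRow (ι := Unit) hM (c • u) v
  rw [← vecMulVec_eq, smul_vecMulVec] at h
  rw [h, Matrix.mul_assoc, ← replicateCol_mulVec, det_unique (n := Unit), Matrix.add_apply,
    one_apply_eq, replicateRow_mul_replicateCol_apply, mulVec_smul, dotProduct_smul, smul_eq_mul]

/-- The quadratic form of the inverse is antitone in the Loewner order. -/
theorem Matrix.PosDef.dotProduct_inv_add_mulVec_le {n : Type*} [Fintype n] [DecidableEq n]
    {M N : Matrix n n ℝ} (hM : M.PosDef) (hN : N.PosSemidef) (x : n → ℝ) :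
    x ⬝ᵥ (M + N)⁻¹ *ᵥ x ≤ x ⬝ᵥ M⁻¹ *ᵥ x := by
  have hMN := hM.add_posSemidef hN
  set u := M⁻¹ *ᵥ x with hu
  set w := (M + N)⁻¹ *ᵥ x with hw
  have hMu : M *ᵥ u = x := by
    rw [hu, mulVec_mulVec, mul_nonsing_inv _ ((isUnit_iff_isUnit_det M).1 hM.isUnit), one_mulVec]
  have hMNw : M *ᵥ w + N *ᵥ w = x := by
    rw [← add_mulVec, hw, mulVec_mulVec,
      mul_nonsing_inv _ ((isUnit_iff_isUnit_det _).1 hMN.isUnit), one_mulVec]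
  have hsq := hM.posSemidef.dotProduct_mulVec_nonneg (u - w)
  have hNw := hN.dotProduct_mulVec_nonneg w
  have hsymm : u ⬝ᵥ M *ᵥ w = x ⬝ᵥ w := by
    have hT : Mᵀ = M := by simpa [IsHermitian] using hM.isHermitian
    rw [dotProduct_mulVec, ← mulVec_transpose, hT, hMu]
  have hxw : w ⬝ᵥ M *ᵥ w + w ⬝ᵥ N *ᵥ w = x ⬝ᵥ w := by
    rw [← dotProduct_add, hMNw, dotProduct_comm]
  simp only [star_trivial, mulVec_sub, hMu, sub_dotProduct, dotProduct_sub, hsymm] at hsq hNw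
  rw [dotProduct_comm u x, dotProduct_comm w x] at hsq
  linarith

theorem Matrix.posSemidef_smul_vecMulVec_self {n : Type*} [Fintype n] {c : ℝ} (hc : 0 ≤ c)
    (x : n → ℝ) : (c • vecMulVec x x).PosSemidef := by
  simpa using (posSemidef_vecMulVec_self_star x).smul hc

theorem Matrix.posSemidef_smul_sum_vecMulVec_self {ι n : Type*} [Fintype n] {c : ℝ} (hc : 0 ≤ c)
    (z : ι → n → ℝ) (U : Finset ι) : (c • ∑ j ∈ U, vecMulVec (z j) (z j)).PosSemidef := by
  rw [Finset.smul_sum]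
  exact posSemidef_sum _ fun j _ => posSemidef_smul_vecMulVec_self hc (z j)

theorem Matrix.PosDef.det_add_add_smul_sum_mul_det_le {ι n : Type*} [Fintype n] [DecidableEq n]
    {P A : Matrix n n ℝ} (hP : P.PosDef) (hA : A.PosSemidef) {c : ℝ} (hc : 0 ≤ c)
    (z : ι → n → ℝ) (U : Finset ι) :
    (P + A + c • ∑ j ∈ U, vecMulVec (z j) (z j)).det * P.det ≤
      (P + A).det * (P + c • ∑ j ∈ U, vecMulVec (z j) (z j)).det := by
  classical
  induction U using Finset.induction_on with
  | empty => simp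
  | insert i U hi ih =>
    have hQ := hP.add_posSemidef (posSemidef_smul_sum_vecMulVec_self hc z U)
    rw [Finset.sum_insert hi, smul_add, add_comm (c • vecMulVec (z i) (z i)), ← add_assoc,
      ← add_assoc]
    set B := c • ∑ j ∈ U, vecMulVec (z j) (z j)
    rw [add_right_comm P A B] at ih ⊢
    have hR := hQ.add_posSemidef hA
    rw [det_add_smul_vecMulVec hR.det_pos.ne'.isUnit, det_add_smul_vecMulVec hQ.det_pos.ne'.isUnit]
    have hle := mul_le_mul_of_nonneg_left (hQ.dotProduct_inv_add_mulVec_le hA (z i)) hc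
    have hnonneg := mul_nonneg hc (hR.inv.posSemidef.dotProduct_mulVec_nonneg (z i))
    rw [star_trivial] at hnonneg
    have hPA := (hP.add_posSemidef hA).det_pos
    calc _ = ((P + B + A).det * P.det) * (1 + c * (z i ⬝ᵥ (P + B + A)⁻¹ *ᵥ z i)) := by ring
      _ ≤ ((P + A).det * (P + B).det) * (1 + c * (z i ⬝ᵥ (P + B)⁻¹ *ᵥ z i)) :=
        mul_le_mul ih (by linarith) (by linarith) (mul_pos hPA hQ.det_pos).le
      _ = _ := by ring

theorem coding_rate_submodular_lattice {Ω : Type*} [Fintype Ω] [DecidableEq Ω]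
    (d : ℕ) (z : Ω → Fin d → ℝ) (l : ℝ) (hl : 0 ≤ l)
    (f : Finset Ω → ℝ)
    (hf : ∀ S : Finset Ω,
      f S = Real.log ((1 : Matrix (Fin d) (Fin d) ℝ)
              + l • ∑ j ∈ S, vecMulVec (z j) (z j)).det)
    (S T : Finset Ω) :
    f (S ∪ T) + f (S ∩ T) ≤ f S + f T := by
  have hST : S ∩ T ∪ S \ T = S := by grind
  have hTS : S ∩ T ∪ T \ S = T := by grind
  have hdST : Disjoint (S ∩ T) (S \ T) := by grind [Finset.disjoint_left]
  have hdTS : Disjoint (S ∩ T) (T \ S) := by grind [Finset.disjoint_left]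
  have hpd (U : Finset Ω) : (1 + l • ∑ j ∈ U, vecMulVec (z j) (z j)).PosDef :=
    PosDef.one.add_posSemidef (posSemidef_smul_sum_vecMulVec_self hl z U)
  have hadd {U V : Finset Ω} (h : Disjoint U V) :
      (1 + l • ∑ j ∈ U, vecMulVec (z j) (z j)) + l • ∑ j ∈ V, vecMulVec (z j) (z j) =
        1 + l • ∑ j ∈ U ∪ V, vecMulVec (z j) (z j) := by
    rw [Finset.sum_union h, smul_add, add_assoc]
  have key := (hpd (S ∩ T)).det_add_add_smul_sum_mul_det_le
    (posSemidef_smul_sum_vecMulVec_self hl z (S \ T)) hl z (T \ S)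
  rw [hadd hdST, hST, hadd Finset.disjoint_sdiff,
    Finset.union_sdiff_self_eq_union, hadd hdTS, hTS] at key
  simp only [hf]
  rw [← Real.log_mul (hpd _).det_pos.ne' (hpd _).det_pos.ne',
    ← Real.log_mul (hpd _).det_pos.ne' (hpd _).det_pos.ne']
  exact Real.log_le_log (mul_pos (hpd _).det_pos (hpd _).det_pos) key
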